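/- arXiv:1906.05112 — 5 statements merged into one kernel-verified Lean document; each statement's English description precedes it below -/
import Mathlib

section
/- The control system ẋ = (u_1, x_3 u_1, u_2) on ℝ³ is null controllable in finite time: for every initial value x⁰ ∈ ℝ³ and every time T > 0 there exist a measurable essentially bounded control u: [0,T]→ℝ² and an absolutely continuous trajectory x: [0,T]→ℝ³ with x(0) = x⁰, x'(t) = (u_1(t), x_3(t) u_1(t), u_2(t)) for a.e. t ∈ [0,T], and x(T) = 0. -/
open MeasureTheory Set Filter Topology

noncomputable def lamD {n : ℕ} (r : Fin n → ℝ) (α : ℝ) (x : Fin n → ℝ) : Fin n → ℝ :=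
  fun i => α ^ (r i) * x i

noncomputable def dConst {n : ℕ} (r : Fin n → ℝ) : ℝ := 2 * ∏ i, r i

noncomputable def dilN {n : ℕ} (r : Fin n → ℝ) (x : Fin n → ℝ) : ℝ :=
  (∑ i, |x i| ^ (dConst r / r i)) ^ (dConst r)⁻¹

def IsHom {n m : ℕ} (f : (Fin n → ℝ) → (Fin m → ℝ) → (Fin n → ℝ))
    (r : Fin n → ℝ) (s : Fin m → ℝ) (τ : ℝ) : Prop :=
  ∀ x u, ∀ α : ℝ, 0 ≤ α →
    f (lamD r α x) (lamD s α u) = fun i => α ^ τ * lamD r α (f x u) i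

def IsTraj {n m : ℕ} (f : (Fin n → ℝ) → (Fin m → ℝ) → (Fin n → ℝ))
    (u : ℝ → Fin m → ℝ) (x : ℝ → Fin n → ℝ) (T : ℝ) : Prop :=
  Measurable u ∧
  (∃ C : ℝ, ∀ᵐ t ∂MeasureTheory.volume, t ∈ Set.Icc (0:ℝ) T → ‖u t‖ ≤ C) ∧
  ∀ t ∈ Set.Icc (0:ℝ) T,
    IntervalIntegrable (fun s => f (x s) (u s)) MeasureTheory.volume 0 t ∧
    x t = x 0 + ∫ s in (0:ℝ)..t, f (x s) (u s)

noncomputable def stageCost {n m : ℕ} (r : Fin n → ℝ) (s : Fin m → ℝ)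
    (x : Fin n → ℝ) (u : Fin m → ℝ) : ℝ :=
  ∑ i, |x i| ^ (dConst r / r i) + ∑ j, |u j| ^ (dConst r / s j)

noncomputable def lstar {n m : ℕ} (ℓ : (Fin n → ℝ) → (Fin m → ℝ) → ℝ)
    (x : Fin n → ℝ) : ℝ :=
  ⨅ u : Fin m → ℝ, ℓ x u

noncomputable def Val {n m : ℕ} (f : (Fin n → ℝ) → (Fin m → ℝ) → (Fin n → ℝ))
    (ℓ : (Fin n → ℝ) → (Fin m → ℝ) → ℝ) (t : ℝ) (x0 : Fin n → ℝ) : ENNReal :=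
  sInf { c | ∃ u x, IsTraj f u x t ∧ x 0 = x0 ∧
      c = ∫⁻ s in Set.Ioc (0:ℝ) t, ENNReal.ofReal (ℓ (x s) (u s)) }

def IsKInfty (ρ : ℝ → ℝ) : Prop :=
  Continuous ρ ∧ ρ 0 = 0 ∧ StrictMonoOn ρ (Set.Ici 0) ∧ ∀ c : ℝ, ∃ x ≥ (0:ℝ), c < ρ x

def LocLipOffZero {n m : ℕ} (f : (Fin n → ℝ) → (Fin m → ℝ) → (Fin n → ℝ)) : Prop :=
  ∀ (u : Fin m → ℝ) (x : Fin n → ℝ), x ≠ 0 →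
    ∃ (K : NNReal) (t : Set (Fin n → ℝ)), t ∈ nhds x ∧ LipschitzOnWith K (fun y => f y u) t

def GANC {n m : ℕ} (f : (Fin n → ℝ) → (Fin m → ℝ) → (Fin n → ℝ)) : Prop :=
  ∀ x0 : Fin n → ℝ, ∃ (u : ℝ → Fin m → ℝ) (x : ℝ → Fin n → ℝ),
    (∀ T > (0:ℝ), IsTraj f u x T) ∧ x 0 = x0 ∧
    Filter.Tendsto x Filter.atTop (nhds 0)

noncomputable def lowerDini {n : ℕ} (V : (Fin n → ℝ) → ℝ) (x v : Fin n → ℝ) : ℝ :=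
  Filter.liminf (fun p : ℝ × (Fin n → ℝ) => (V (x + p.1 • p.2) - V x) / p.1)
    ((nhdsWithin 0 (Set.Ioi 0)) ×ˢ nhds v)

noncomputable def hRobot (x : Fin 3 → ℝ) (u : Fin 2 → ℝ) : Fin 3 → ℝ :=
  ![u 0, x 2 * u 0, u 1]

/-- A continuously differentiable curve solving the system with a continuous control is a
trajectory. -/
theorem isTraj_of_hasDerivAt {n m : ℕ} {f : (Fin n → ℝ) → (Fin m → ℝ) → (Fin n → ℝ)}
    {u : ℝ → Fin m → ℝ} {x : ℝ → Fin n → ℝ} (T : ℝ) (hu : Continuous u)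
    (hf : Continuous fun t => f (x t) (u t))
    (hx : ∀ t, HasDerivAt x (f (x t) (u t)) t) : IsTraj f u x T := by
  refine ⟨hu.measurable, ?_, fun t _ => ⟨hf.intervalIntegrable 0 t, ?_⟩⟩
  · obtain ⟨C, hC⟩ := (isCompact_Icc (a := (0 : ℝ)) (b := T)).exists_bound_of_continuousOn
      hu.continuousOn
    exact ⟨C, Eventually.of_forall hC⟩
  · rw [intervalIntegral.integral_eq_sub_of_hasDerivAt (fun s _ => hx s)
      (hf.intervalIntegrable 0 t)]
    abel

/-- the system ẋ = (u₁, x₃u₁, u₂) is null controllable in finite time. -/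
theorem stmt4 :
    ∀ (x0 : Fin 3 → ℝ) (T : ℝ), 0 < T →
      ∃ (u : ℝ → Fin 2 → ℝ) (x : ℝ → Fin 3 → ℝ),
        IsTraj hRobot u x T ∧ x 0 = x0 ∧ x T = 0 := by
  intro x0 T hT
  obtain ⟨a, ha⟩ : ∃ a, a = x0 0 := ⟨_, rfl⟩
  obtain ⟨b, hb⟩ : ∃ b, b = x0 1 := ⟨_, rfl⟩
  obtain ⟨c, hc⟩ : ∃ c, c = x0 2 := ⟨_, rfl⟩
  obtain ⟨k, hk⟩ : ∃ k, k = -b + a * c / 2 - 5 * c := ⟨_, rfl⟩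
  let p : ℝ → Fin 3 → ℝ := fun s =>
    ![a * (1 - s) + 30 * s * (1 - s),
      b + c * ((30 - a) * s - (90 - a) * s ^ 2 / 2 + 20 * s ^ 3)
        + k * ((30 - a) * s ^ 2 / 2 - (50 - a) * s ^ 3 + (60 - a / 2) * s ^ 4 - 24 * s ^ 5),
      c * (1 - s) + k * (s - 3 * s ^ 2 + 2 * s ^ 3)]
  let v : ℝ → Fin 2 → ℝ := fun s =>
    ![(30 - a - 60 * s) / T, (-c + k * (1 - 6 * s + 6 * s ^ 2)) / T]
  refine ⟨fun t => v (t / T), fun t => p (t / T), isTraj_of_hasDerivAt T ?_ ?_ ?_, ?_, ?_⟩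
  · refine continuous_pi fun i => ?_
    fin_cases i <;> simp [v] <;> fun_prop
  · refine continuous_pi fun i => ?_
    fin_cases i <;> simp [v, p, hRobot] <;> fun_prop
  · intro t
    have hs : HasDerivAt (fun t : ℝ => t / T) (1 / T) t := (hasDerivAt_id t).div_const T
    have h1 := hs.const_sub 1
    have hpow (n : ℕ) := hs.pow n
    refine hasDerivAt_pi.2 fun i => ?_
    fin_cases i
    · refine ((h1.const_mul a).add ((hs.const_mul 30).mul h1)).congr_deriv ?_
      simp [hRobot, v]
      ring
    · refine ((((((hs.const_mul (30 - a)).sub (((hpow 2).const_mul (90 - a)).div_const 2)).add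
        ((hpow 3).const_mul 20)).const_mul c).const_add b).add
        (((((((hpow 2).const_mul (30 - a)).div_const 2).sub ((hpow 3).const_mul (50 - a))).add
        ((hpow 4).const_mul (60 - a / 2))).sub ((hpow 5).const_mul 24)).const_mul k)).congr_deriv ?_
      simp [hRobot, v, p]
      ring
    · refine ((h1.const_mul c).add (((hs.sub ((hpow 2).const_mul 3)).add
        ((hpow 3).const_mul 2)).const_mul k)).congr_deriv ?_
      simp [hRobot, v]
      ring
  · funext i
    fin_cases i <;> simp [p, ha, hb, hc]
  · funext i
    fin_cases i
    · simp [p, hT.ne']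
    · simp [p, hT.ne', hk]
      ring
    · norm_num [p, hT.ne']
end

section
/- Fix k > 0 and define V: ℝ→ℝ by V(x) = (2(1+√2)/(k+1))·|x|^{k+1}. Then V is differentiable on ℝ∖{0} with V'(x) = 2(1+√2)|x|^k sign(x), and for every x ∈ ℝ∖{0} the Hamilton–Jacobi equation inf_{u∈ℝ} [ V'(x)·(|x|^k sign(x) + u) + |x|^{2k} + u² ] = 0 holds, with the infimum attained at u* = −(1+√2)|x|^k sign(x) = −V'(x)/2. -/
open MeasureTheory Set Filter Topology

lemma sq_sign_of_ne_zero {x : ℝ} (hx : x ≠ 0) : Real.sign x ^ 2 = 1 := by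
  rcases Real.sign_apply_eq_of_ne_zero x hx with h | h <;> simp [h]

lemma hasDerivAt_abs_rpow_add_one (k : ℝ) {x : ℝ} (hx : x ≠ 0) :
    HasDerivAt (fun y : ℝ => |y| ^ (k + 1)) ((k + 1) * (|x| ^ k * Real.sign x)) x := by
  have habs : HasDerivAt (fun y : ℝ => |y|) (Real.sign x) x := by
    rcases hx.lt_or_gt with h | h
    · simpa [Real.sign_of_neg h] using hasDerivAt_abs_neg h
    · simpa [Real.sign_of_pos h] using hasDerivAt_abs_pos h
  convert habs.rpow_const (p := k + 1) (Or.inl (abs_ne_zero.mpr hx)) using 1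
  rw [add_sub_cancel_right]
  ring

/-- explicit solution of the Hamilton–Jacobi equation for the
scalar system ẋ = |x|^k sign x + u with stage cost |x|^{2k} + u². -/
theorem stmt9 (k : ℝ) (hk : 0 < k) :
    ∀ x : ℝ, x ≠ 0 →
      HasDerivAt (fun y : ℝ => 2 * (1 + Real.sqrt 2) / (k + 1) * |y| ^ (k + 1))
        (2 * (1 + Real.sqrt 2) * |x| ^ k * Real.sign x) x ∧
      (∀ u : ℝ, 0 ≤ 2 * (1 + Real.sqrt 2) * |x| ^ k * Real.sign x
            * (|x| ^ k * Real.sign x + u) + |x| ^ (2 * k) + u ^ 2) ∧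
      (2 * (1 + Real.sqrt 2) * |x| ^ k * Real.sign x
            * (|x| ^ k * Real.sign x + (-(1 + Real.sqrt 2) * |x| ^ k * Real.sign x))
          + |x| ^ (2 * k) + (-(1 + Real.sqrt 2) * |x| ^ k * Real.sign x) ^ 2 = 0) ∧
      (-(1 + Real.sqrt 2) * |x| ^ k * Real.sign x
          = -(2 * (1 + Real.sqrt 2) * |x| ^ k * Real.sign x) / 2) := by
  intro x hx
  have hsqrt : Real.sqrt 2 ^ 2 = 2 := Real.sq_sqrt (by norm_num)
  have hcost : |x| ^ (2 * k) = (|x| ^ k * Real.sign x) ^ 2 := by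
    rw [two_mul, Real.rpow_add (abs_pos.mpr hx), mul_pow, sq_sign_of_ne_zero hx, mul_one, sq]
  have hcompl (y u : ℝ) : 2 * (1 + Real.sqrt 2) * y * (y + u) + y ^ 2 + u ^ 2
      = (u + (1 + Real.sqrt 2) * y) ^ 2 := by
    linear_combination -y ^ 2 * hsqrt
  refine ⟨?_, fun u => ?_, ?_, by ring⟩
  · have hk1 : k + 1 ≠ 0 := by positivity
    refine ((hasDerivAt_abs_rpow_add_one k hx).const_mul
      (2 * (1 + Real.sqrt 2) / (k + 1))).congr_deriv ?_
    field_simp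
  · rw [hcost, mul_assoc _ (|x| ^ k), hcompl]
    positivity
  · rw [hcost, mul_assoc _ (|x| ^ k), mul_assoc _ (|x| ^ k), hcompl]
    ring
end

section
/- Let f: ℝⁿ×ℝᵐ→ℝⁿ and a stage cost ℓ: ℝⁿ×ℝᵐ→[0,∞) be given, with ℓ*(x) := inf_{u} ℓ(x,u), and suppose ℓ* is continuous. Assume there is a continuous function C: [0,∞)×ℝⁿ→[0,1], nonincreasing in its first argument, with C(t,x) < 1 for all x ∈ ℝⁿ and t > 0, such that V_t(x) ≤ t·C(t,x)·ℓ*(x) for all (t,x) ∈ [0,∞)×ℝⁿ. Let T > 0, x⁰ ∈ ℝⁿ, and let (x*, u*) be an optimal pair for horizon T, i.e. a measurable essentially bounded control u* and an absolutely continuous trajectory x* on [0,T] with x*(0) = x⁰, (x*)' = f(x*,u*) a.e., and ∫₀^T ℓ(x*(t),u*(t)) dt = V_T(x⁰). Then ℓ*(x*(T)) = inf_{t∈[0,T]} ℓ*(x*(t)). -/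
open MeasureTheory Set Filter Topology

theorem lstar_nonneg {n m : ℕ} {ℓ : (Fin n → ℝ) → (Fin m → ℝ) → ℝ} (hℓ : ∀ x u, 0 ≤ ℓ x u)
    (x : Fin n → ℝ) : 0 ≤ lstar ℓ x :=
  Real.iInf_nonneg (hℓ x)

theorem lstar_le {n m : ℕ} {ℓ : (Fin n → ℝ) → (Fin m → ℝ) → ℝ} (hℓ : ∀ x u, 0 ≤ ℓ x u)
    (x : Fin n → ℝ) (u : Fin m → ℝ) : lstar ℓ x ≤ ℓ x u :=
  ciInf_le ⟨0, by rintro _ ⟨v, rfl⟩; exact hℓ x v⟩ u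

theorem IsTraj.continuousOn {n m : ℕ} {f : (Fin n → ℝ) → (Fin m → ℝ) → (Fin n → ℝ)}
    {u : ℝ → Fin m → ℝ} {x : ℝ → Fin n → ℝ} {T : ℝ} (h : IsTraj f u x T) (hT : 0 ≤ T) :
    ContinuousOn x (Icc 0 T) := by
  have hint := (h.2.2 T ⟨hT, le_rfl⟩).1
  have hcont : ContinuousOn (fun t => ∫ s in (0 : ℝ)..t, f (x s) (u s)) (uIcc 0 T) :=
    intervalIntegral.continuousOn_primitive_interval
      (by rwa [uIcc_of_le hT, integrableOn_Icc_iff_integrableOn_Ioc,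
        ← intervalIntegrable_iff_integrableOn_Ioc_of_le hT])
  rw [uIcc_of_le hT] at hcont
  exact (continuousOn_const.add hcont).congr fun t ht => (h.2.2 t ht).2

/-- Follow `a` up to time `τ`, then `b` restarted at time `τ`. -/
noncomputable def concat {E : Type*} (τ : ℝ) (a b : ℝ → E) (s : ℝ) : E :=
  if s ≤ τ then a s else b (s - τ)

theorem concat_of_le {E : Type*} {τ s : ℝ} (a b : ℝ → E) (h : s ≤ τ) :
    concat τ a b s = a s := if_pos h

theorem concat_of_lt {E : Type*} {τ s : ℝ} (a b : ℝ → E) (h : τ < s) :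
    concat τ a b s = b (s - τ) := if_neg h.not_ge

theorem IsTraj.concat {n m : ℕ} {f : (Fin n → ℝ) → (Fin m → ℝ) → (Fin n → ℝ)}
    {u v : ℝ → Fin m → ℝ} {x y : ℝ → Fin n → ℝ} {τ T : ℝ} (hτ : τ ∈ Icc 0 T)
    (hx : IsTraj f u x T) (hy : IsTraj f v y (T - τ)) (hxy : y 0 = x τ) :
    IsTraj f (concat τ u v) (concat τ x y) T := by
  obtain ⟨hu, ⟨A, hA⟩, hx⟩ := hx
  obtain ⟨hv, ⟨B, hB⟩, hy⟩ := hy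
  refine ⟨Measurable.ite measurableSet_Iic hu (hv.comp (measurable_id.sub_const τ)),
    ⟨max A B, ?_⟩, fun t ht => ?_⟩
  · have hB' := (measurePreserving_sub_right volume τ).quasiMeasurePreserving.ae hB
    filter_upwards [hA, hB'] with s hs hs' hsT
    rcases le_or_gt s τ with h | h
    · rw [concat_of_le _ _ h]
      exact (hs hsT).trans (le_max_left _ _)
    · rw [concat_of_lt _ _ h]
      exact (hs' ⟨by linarith, by linarith [hsT.2]⟩).trans (le_max_right _ _)
  · have early (r : ℝ) (hr : 0 ≤ r) (hrτ : r ≤ τ) :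
        EqOn (fun s => f (x s) (u s)) (fun s => f (_root_.concat τ x y s) (_root_.concat τ u v s))
          (uIoc 0 r) := by
      intro s hs
      rw [uIoc_of_le hr] at hs
      simp only [concat_of_le _ _ (hs.2.trans hrτ)]
    have heq0 : _root_.concat τ x y 0 = x 0 := concat_of_le _ _ hτ.1
    rcases le_or_gt t τ with h | h
    · have e := early t ht.1 h
      obtain ⟨h1, h2⟩ := hx t ht
      refine ⟨h1.congr e, ?_⟩
      rw [concat_of_le _ _ h, heq0, h2]
      congr 1
      exact intervalIntegral.integral_congr_ae (ae_of_all _ e)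
    · have e := early τ hτ.1 le_rfl
      obtain ⟨h1, h2⟩ := hx τ hτ
      obtain ⟨h3, h4⟩ := hy (t - τ) ⟨by linarith, by linarith [ht.2]⟩
      have e' : EqOn (fun s => f (y (s - τ)) (v (s - τ)))
          (fun s => f (_root_.concat τ x y s) (_root_.concat τ u v s)) (uIoc τ t) := by
        intro s hs
        rw [uIoc_of_le h.le] at hs
        simp only [concat_of_lt _ _ hs.1]
      have h5 : IntervalIntegrable (fun s => f (y (s - τ)) (v (s - τ))) volume τ t := by
        simpa using h3.comp_sub_right τ
      refine ⟨(h1.congr e).trans (h5.congr e'), ?_⟩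
      rw [← intervalIntegral.integral_add_adjacent_intervals (h1.congr e) (h5.congr e'),
        ← intervalIntegral.integral_congr_ae (ae_of_all _ e),
        ← intervalIntegral.integral_congr_ae (ae_of_all _ e'),
        intervalIntegral.integral_comp_sub_right (fun s => f (y s) (v s)), sub_self,
        concat_of_lt _ _ h, heq0, h4, hxy, h2, add_assoc]

theorem setLIntegral_Ioc_sub_right (F : ℝ → ENNReal) (τ T : ℝ) :
    ∫⁻ s in Ioc τ T, F (s - τ) = ∫⁻ s in Ioc 0 (T - τ), F s := by
  have h := (measurePreserving_sub_right volume τ).setLIntegral_comp_preimage_emb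
    (MeasurableEquiv.subRight τ).measurableEmbedding F (Ioc 0 (T - τ))
  simpa using h

theorem setLIntegral_Ioc_add_adjacent (F : ℝ → ENNReal) {a b c : ℝ} (hab : a ≤ b) (hbc : b ≤ c) :
    ∫⁻ s in Ioc a c, F s = (∫⁻ s in Ioc a b, F s) + ∫⁻ s in Ioc b c, F s := by
  rw [← Ioc_union_Ioc_eq_Ioc hab hbc,
    lintegral_union measurableSet_Ioc (Ioc_disjoint_Ioc_of_le le_rfl)]

/-- Tails of optimal pairs are optimal. -/
theorem setLIntegral_tail_le_Val {n m : ℕ} {f : (Fin n → ℝ) → (Fin m → ℝ) → (Fin n → ℝ)}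
    {ℓ : (Fin n → ℝ) → (Fin m → ℝ) → ℝ} {u : ℝ → Fin m → ℝ} {x : ℝ → Fin n → ℝ} {τ T : ℝ}
    (hτ : τ ∈ Icc 0 T) (hx : IsTraj f u x T)
    (hopt : ∫⁻ s in Ioc 0 T, ENNReal.ofReal (ℓ (x s) (u s)) = Val f ℓ T (x 0))
    (hfin : Val f ℓ T (x 0) ≠ ⊤) :
    ∫⁻ s in Ioc τ T, ENNReal.ofReal (ℓ (x s) (u s)) ≤ Val f ℓ (T - τ) (x τ) := by
  refine le_sInf ?_
  rintro _ ⟨v, y, hy, hxy, rfl⟩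
  have hsplit := setLIntegral_Ioc_add_adjacent
    (fun s => ENNReal.ofReal (ℓ (x s) (u s))) hτ.1 hτ.2
  have hle : Val f ℓ T (x 0) ≤
      ∫⁻ s in Ioc 0 T, ENNReal.ofReal (ℓ (concat τ x y s) (concat τ u v s)) :=
    sInf_le ⟨_, _, hx.concat hτ hy hxy, concat_of_le _ _ hτ.1, rfl⟩
  have h1 : ∫⁻ s in Ioc 0 τ, ENNReal.ofReal (ℓ (concat τ x y s) (concat τ u v s)) =
      ∫⁻ s in Ioc 0 τ, ENNReal.ofReal (ℓ (x s) (u s)) :=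
    setLIntegral_congr_fun measurableSet_Ioc fun s hs => by simp only [concat_of_le _ _ hs.2]
  have h2 : ∫⁻ s in Ioc τ T, ENNReal.ofReal (ℓ (concat τ x y s) (concat τ u v s)) =
      ∫⁻ s in Ioc τ T, ENNReal.ofReal (ℓ (y (s - τ)) (v (s - τ))) :=
    setLIntegral_congr_fun measurableSet_Ioc fun s hs => by simp only [concat_of_lt _ _ hs.1]
  rw [setLIntegral_Ioc_add_adjacent _ hτ.1 hτ.2, h1, h2,
    setLIntegral_Ioc_sub_right (fun s => ENNReal.ofReal (ℓ (y s) (v s))), ← hopt, hsplit] at hle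
  refine (ENNReal.add_le_add_iff_left ?_).1 hle
  refine ne_top_of_le_ne_top hfin ?_
  rw [← hopt, hsplit]
  exact le_self_add

/-- along an optimal trajectory the minimized stage cost attains its
minimum over [0,T] at the final time. -/
theorem stmt13 {n m : ℕ}
    (f : (Fin n → ℝ) → (Fin m → ℝ) → (Fin n → ℝ))
    (ℓ : (Fin n → ℝ) → (Fin m → ℝ) → ℝ) (hℓnn : ∀ x u, 0 ≤ ℓ x u)
    (hlc : Continuous (lstar ℓ))
    (C : ℝ → (Fin n → ℝ) → ℝ)
    (hCc : Continuous (Function.uncurry C))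
    (hCanti : ∀ x : Fin n → ℝ, AntitoneOn (fun t => C t x) (Set.Ici 0))
    (hC01 : ∀ t ≥ (0:ℝ), ∀ x : Fin n → ℝ, C t x ∈ Set.Icc (0:ℝ) 1)
    (hClt : ∀ x : Fin n → ℝ, ∀ t > (0:ℝ), C t x < 1)
    (hgrow : ∀ t ≥ (0:ℝ), ∀ x : Fin n → ℝ,
      Val f ℓ t x ≤ ENNReal.ofReal (t * C t x * lstar ℓ x))
    (T : ℝ) (hT : 0 < T) (x0 : Fin n → ℝ)
    (ustar : ℝ → Fin m → ℝ) (xstar : ℝ → Fin n → ℝ)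
    (htraj : IsTraj f ustar xstar T) (hinit : xstar 0 = x0)
    (hopt : (∫⁻ s in Set.Ioc (0:ℝ) T, ENNReal.ofReal (ℓ (xstar s) (ustar s)))
      = Val f ℓ T x0) :
    lstar ℓ (xstar T) = sInf ((fun t => lstar ℓ (xstar t)) '' Set.Icc (0:ℝ) T) := by
  subst hinit
  have hg : ContinuousOn (fun t => lstar ℓ (xstar t)) (Icc 0 T) :=
    hlc.comp_continuousOn (htraj.continuousOn hT.le)
  obtain ⟨τ, hτ, hmin⟩ := isCompact_Icc.exists_isMinOn (nonempty_Icc.2 hT.le) hg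
  have hmin' : ∀ t ∈ Icc 0 T, lstar ℓ (xstar τ) ≤ lstar ℓ (xstar t) := fun t ht => hmin ht
  have hleast : IsLeast ((fun t => lstar ℓ (xstar t)) '' Icc 0 T) (lstar ℓ (xstar τ)) :=
    ⟨mem_image_of_mem _ hτ, by rintro _ ⟨t, ht, rfl⟩; exact hmin' t ht⟩
  rw [hleast.csInf_eq]
  by_contra hne
  have hlt : lstar ℓ (xstar τ) < lstar ℓ (xstar T) :=
    lt_of_le_of_ne (hmin' T ⟨hT.le, le_rfl⟩) (Ne.symm hne)
  have hτT : τ < T := hτ.2.lt_of_ne (by rintro rfl; exact hne rfl)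
  have hsub : Icc τ T ⊆ Icc 0 T := Icc_subset_Icc_left hτ.1
  have hstrict : ∫ _ in τ..T, lstar ℓ (xstar τ) < ∫ s in τ..T, lstar ℓ (xstar s) :=
    intervalIntegral.integral_lt_integral_of_continuousOn_of_le_of_exists_lt hτT
      continuousOn_const (hg.mono hsub)
      (fun s hs => hmin' s (hsub (Ioc_subset_Icc_self hs))) ⟨T, ⟨hτT.le, le_rfl⟩, hlt⟩
  rw [intervalIntegral.integral_const, smul_eq_mul] at hstrict
  have hfin : Val f ℓ T (xstar 0) ≠ ⊤ :=
    ne_top_of_le_ne_top ENNReal.ofReal_ne_top (hgrow T hT.le _)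
  have hT0 : 0 ≤ T - τ := sub_nonneg.2 hτT.le
  have hnn := lstar_nonneg hℓnn (xstar τ)
  have hup : ENNReal.ofReal (∫ s in τ..T, lstar ℓ (xstar s)) ≤
      ENNReal.ofReal ((T - τ) * C (T - τ) (xstar τ) * lstar ℓ (xstar τ)) := by
    rw [intervalIntegral.integral_of_le hτT.le, ofReal_integral_eq_lintegral_ofReal
      ((hg.mono hsub).integrableOn_Icc.mono_set Ioc_subset_Icc_self)
      (ae_of_all _ fun s => lstar_nonneg hℓnn _)]
    calc _ ≤ ∫⁻ s in Ioc τ T, ENNReal.ofReal (ℓ (xstar s) (ustar s)) :=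
          lintegral_mono fun s => ENNReal.ofReal_le_ofReal (lstar_le hℓnn _ _)
      _ ≤ Val f ℓ (T - τ) (xstar τ) := setLIntegral_tail_le_Val hτ htraj hopt hfin
      _ ≤ _ := hgrow _ hT0 _
  have hC := hC01 (T - τ) hT0 (xstar τ)
  rw [ENNReal.ofReal_le_ofReal_iff (mul_nonneg (mul_nonneg hT0 hC.1) hnn)] at hup
  have hCle : (T - τ) * C (T - τ) (xstar τ) * lstar ℓ (xstar τ) ≤
      (T - τ) * lstar ℓ (xstar τ) :=
    mul_le_mul_of_nonneg_right (mul_le_of_le_one_right hT0 hC.2) hnn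
  linarith
end

section
/- Let x⁰ ∈ ℝ with x⁰ ≠ 0 and define x: [0,∞)→ℝ by x(t) = x⁰/(1 + |x⁰|t). Then x is differentiable with x'(t) = −|x(t)|·x(t) for all t ≥ 0 (i.e. x solves ẋ = −|x|(x+u) with u ≡ 0 and x(0) = x⁰), and for every t > 0 the running cost with stage cost ℓ(x,u) = |x| + |u| satisfies ∫₀^t |x(s)| ds = ln(1 + |x⁰|t) < t·|x⁰|. -/
open MeasureTheory Set Filter Topology

/-- explicit solution of ẋ = -|x|x and its running cost. -/
theorem stmt15 (x0 : ℝ) (hx0 : x0 ≠ 0) :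
    (∀ t ≥ (0:ℝ),
      HasDerivAt (fun t : ℝ => x0 / (1 + |x0| * t))
        (-(|x0 / (1 + |x0| * t)| * (x0 / (1 + |x0| * t)))) t) ∧
    ∀ t > (0:ℝ),
      (∫ s in (0:ℝ)..t, |x0 / (1 + |x0| * s)|) = Real.log (1 + |x0| * t) ∧
      Real.log (1 + |x0| * t) < t * |x0| := by
  have ha : 0 < |x0| := abs_pos.mpr hx0
  have hpos : ∀ t : ℝ, 0 ≤ t → 0 < 1 + |x0| * t := fun t ht => by positivity
  have hlin : ∀ t : ℝ, HasDerivAt (fun t : ℝ => 1 + |x0| * t) |x0| t := fun t => by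
    simpa using ((hasDerivAt_id t).const_mul |x0|).const_add 1
  refine ⟨fun t ht => ?_, fun t ht => ⟨?_, ?_⟩⟩
  · have h := hpos t ht
    refine ((hasDerivAt_const t x0).fun_div (hlin t) h.ne').congr_deriv ?_
    rw [abs_div, abs_of_pos h]
    field_simp
    ring
  · have hmem : ∀ s ∈ uIcc 0 t, 0 < 1 + |x0| * s := fun s hs =>
      hpos s (by rw [uIcc_of_le ht.le] at hs; exact hs.1)
    have hcont : ContinuousOn (fun s : ℝ => |x0 / (1 + |x0| * s)|) (uIcc 0 t) :=
      (continuousOn_const.div (by fun_prop) fun s hs => (hmem s hs).ne').abs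
    rw [intervalIntegral.integral_eq_sub_of_hasDerivAt
      (f := fun s : ℝ => Real.log (1 + |x0| * s)) (fun s hs => ?_) hcont.intervalIntegrable]
    · simp
    · rw [abs_div, abs_of_pos (hmem s hs)]
      exact (hlin s).log (hmem s hs).ne'
  · have h := Real.log_lt_sub_one_of_pos (hpos t ht.le) (by simp [hx0, ht.ne'])
    linarith
end

section
/- Consider the nonholonomic robot vector field f(x,u) = (u_1 cos x_3, u_1 sin x_3, u_2) on ℝ³×ℝ² and its homogeneous approximation h(x,u) = (u_1, x_3 u_1, u_2), which is (r,s,0)-homogeneous with r = (1,2,1) and s = (1,1). Let R := f − h, so R(x,u) = ((cos x_3 − 1)u_1, (sin x_3 − x_3)u_1, 0). Then for every ρ > 0, setting M := max{ρ³/2, ρ⁴/6}, the approximation bound |R_i(Λ_α x, Δ_α u)| ≤ M α^{r_i + η} holds for every i ∈ {1,2,3}, every η ∈ (0,2], all (x,u) with max_i |x_i| ≤ ρ and max_j |u_j| ≤ ρ, and all α ∈ (0,1], where Λ_α = diag(α, α², α) and Δ_α = diag(α, α). -/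
open MeasureTheory Set Filter Topology

noncomputable def fRobot (x : Fin 3 → ℝ) (u : Fin 2 → ℝ) : Fin 3 → ℝ :=
  ![u 0 * Real.cos (x 2), u 0 * Real.sin (x 2), u 1]

theorem abs_cos_sub_one_le (y : ℝ) : |Real.cos y - 1| ≤ |y| ^ 2 / 2 := by
  rw [sq_abs, abs_le]
  constructor
  · linarith [Real.one_sub_sq_div_two_le_cos (x := y)]
  · nlinarith [Real.cos_le_one y, sq_nonneg y]

theorem abs_sin_sub_self_le (y : ℝ) : |Real.sin y - y| ≤ |y| ^ 3 / 6 := by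
  wlog hy : 0 ≤ y generalizing y
  · have h := this (-y) (by linarith)
    rwa [Real.sin_neg, abs_neg, ← neg_sub', abs_neg] at h
  · rw [abs_of_nonneg hy, abs_le]
    constructor
    · linarith [Real.sin_ge_sub_cube hy]
    · have := Real.sin_le hy
      have := pow_nonneg hy 3
      linarith

theorem pow_le_rpow_add {α η c : ℝ} (hα : α ∈ Set.Ioc (0 : ℝ) 1) {k : ℕ} (h : c + η ≤ k) :
    α ^ k ≤ α ^ (c + η) := by
  rw [← Real.rpow_natCast]
  exact Real.rpow_le_rpow_of_exponent_ge hα.1 hα.2 h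

theorem isHom_hRobot : IsHom hRobot ![1,2,1] ![1,1] 0 := by
  intro x u α _
  funext i
  fin_cases i <;> simp [hRobot, lamD]
  ring

/-- the nonholonomic robot admits (u₁, x₃u₁, u₂) as homogeneous
approximation at the origin, with explicit constants in the approximation bound. -/
theorem stmt19 :
    IsHom hRobot ![1,2,1] ![1,1] 0 ∧
    ∀ ρ > (0:ℝ), ∀ η ∈ Set.Ioc (0:ℝ) 2, ∀ (i : Fin 3) (x : Fin 3 → ℝ) (u : Fin 2 → ℝ),
      (∀ i, |x i| ≤ ρ) → (∀ j, |u j| ≤ ρ) → ∀ α ∈ Set.Ioc (0:ℝ) 1,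
      |fRobot (lamD ![1,2,1] α x) (lamD ![1,1] α u) i
          - hRobot (lamD ![1,2,1] α x) (lamD ![1,1] α u) i|
        ≤ max (ρ ^ 3 / 2) (ρ ^ 4 / 6) * α ^ ((![1,2,1] : Fin 3 → ℝ) i + η) := by
  refine ⟨isHom_hRobot, ?_⟩
  intro ρ hρ η hη i x u hx hu α hα
  have hα0 : 0 ≤ α := hα.1.le
  have hu0 : |α * u 0| ≤ α * ρ := by
    rw [abs_mul, abs_of_nonneg hα0]
    exact mul_le_mul_of_nonneg_left (hu 0) hα0
  have hx2 : |α * x 2| ≤ α * ρ := by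
    rw [abs_mul, abs_of_nonneg hα0]
    exact mul_le_mul_of_nonneg_left (hx 2) hα0
  fin_cases i
  · have key : |α * u 0 * Real.cos (α * x 2) - α * u 0| ≤
        max (ρ ^ 3 / 2) (ρ ^ 4 / 6) * α ^ (1 + η) :=
      calc |α * u 0 * Real.cos (α * x 2) - α * u 0|
          = |α * u 0| * |Real.cos (α * x 2) - 1| := by rw [← abs_mul]; ring_nf
        _ ≤ (α * ρ) * (|α * x 2| ^ 2 / 2) := by gcongr; exact abs_cos_sub_one_le _
        _ ≤ (α * ρ) * ((α * ρ) ^ 2 / 2) := by gcongr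
        _ = ρ ^ 3 / 2 * α ^ 3 := by ring
        _ ≤ max (ρ ^ 3 / 2) (ρ ^ 4 / 6) * α ^ (1 + η) := by
          gcongr
          · exact le_max_left _ _
          · exact pow_le_rpow_add hα (by push_cast; linarith [hη.2])
    simpa [fRobot, hRobot, lamD] using key
  · have key : |α * u 0 * Real.sin (α * x 2) - α * x 2 * (α * u 0)| ≤
        max (ρ ^ 3 / 2) (ρ ^ 4 / 6) * α ^ (2 + η) :=
      calc |α * u 0 * Real.sin (α * x 2) - α * x 2 * (α * u 0)|
          = |α * u 0| * |Real.sin (α * x 2) - α * x 2| := by rw [← abs_mul]; ring_nf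
        _ ≤ (α * ρ) * (|α * x 2| ^ 3 / 6) := by gcongr; exact abs_sin_sub_self_le _
        _ ≤ (α * ρ) * ((α * ρ) ^ 3 / 6) := by gcongr
        _ = ρ ^ 4 / 6 * α ^ 4 := by ring
        _ ≤ max (ρ ^ 3 / 2) (ρ ^ 4 / 6) * α ^ (2 + η) := by
          gcongr
          · exact le_max_right _ _
          · exact pow_le_rpow_add hα (by push_cast; linarith [hη.2])
    simpa [fRobot, hRobot, lamD] using key
  · have : 0 ≤ max (ρ ^ 3 / 2) (ρ ^ 4 / 6) * α ^ (1 + η) := by positivity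
    simpa [fRobot, hRobot, lamD] using this
end
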